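/- arXiv:1308.2344 — 2 statements merged into one kernel-verified Lean document; each statement's English description precedes it below -/
import Mathlib

section
/- Let n ≥ 1, let D_{2n} be the dihedral group of order 2n, and let k = r^i be a rotation element. For a uniformly random subset S of D_{2n}, P(k ∉ S·S) ≤ (3/4)^{n/2} · (9/10)^n. Formally: for i : ZMod n, ((Finset.univ.powerset.filter (fun S => DihedralGroup.r i ∉ S * S)).card : ℝ) / 2^(2n) ≤ (3/4) ^ ((n : ℝ)/2) * (9/10)^n, where the first power is a real power. (The paper states the second factor as (φ/2)^n with φ the golden ratio, noting that 1.8 ≥ φ is used as a crude bound so that the inequality with base 9/10 = 1.8/2 holds for all n.) -/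
open Finset
open scoped Pointwise

/-- If `g` is an involution, the number of sets disjoint from their image under `g` is at most
`3 ^ (|α| / 2)`. -/
lemma card_filter_involutive_sq_le {α : Type*} [Fintype α] [DecidableEq α] {g : α → α}
    (hg : Function.Involutive g) :
    #{A : Finset α | ∀ x ∈ A, g x ∉ A} ^ 2 ≤ 3 ^ Fintype.card α := by
  set F : Finset (Finset α) := {A : Finset α | ∀ x ∈ A, g x ∉ A} with hF
  let e := Fintype.equivFin α
  have hcard : #(Fintype.piFinset
      (fun _ : α => ({p : Bool × Bool | (p.1 && p.2) = false} : Finset (Bool × Bool))))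
      = 3 ^ Fintype.card α := by
    rw [Fintype.card_piFinset, prod_const, card_univ]
    rfl
  rw [← hcard, sq, ← card_product]
  refine card_le_card_of_injOn
    (fun P x => if e x ≤ e (g x) then (decide (x ∈ P.1), decide (g x ∈ P.1))
      else (decide (x ∈ P.2), decide (g x ∈ P.2))) ?_ ?_
  · rintro ⟨A, B⟩ hAB
    simp only [hF, coe_product, Set.mem_prod, mem_coe, mem_filter, mem_univ, true_and] at hAB
    simp only [mem_coe, Fintype.mem_piFinset, mem_filter, mem_univ, true_and]
    intro x
    have h1 := hAB.1 x
    have h2 := hAB.2 x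
    split_ifs <;> simpa
  · rintro ⟨A, B⟩ hAB ⟨A', B'⟩ hAB' h
    simp only [hF, coe_product, Set.mem_prod, mem_coe, mem_filter, mem_univ, true_and]
      at hAB hAB'
    have key (x : α) : (x ∈ A ↔ x ∈ A') ∧ (x ∈ B ↔ x ∈ B') := by
      have h1 := congrFun h x
      have h2 := congrFun h (g x)
      simp only [hg x] at h1 h2
      rcases lt_trichotomy (e x) (e (g x)) with hlt | heq | hgt
      · simp only [hlt.le, hlt.not_ge, if_true, if_false, Prod.mk.injEq, decide_eq_decide]
          at h1 h2
        exact ⟨h1.1, h2.2⟩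
      · have hx : g x = x := (e.injective heq).symm
        have a1 := hAB.1 x
        have a2 := hAB.2 x
        have a3 := hAB'.1 x
        have a4 := hAB'.2 x
        rw [hx] at a1 a2 a3 a4
        tauto
      · simp only [hgt.le, hgt.not_ge, if_true, if_false, Prod.mk.injEq, decide_eq_decide]
          at h1 h2
        exact ⟨h2.2, h1.1⟩
    exact Prod.ext (Finset.ext fun x => (key x).1) (Finset.ext fun x => (key x).2)

/-- The subsets of `{0, …, m - 1}` without two consecutive elements. -/
def sparseSubsets (m : ℕ) : Finset (Finset ℕ) :=
  {C ∈ (range m).powerset | ∀ j ∈ C, j + 1 ∉ C}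

lemma mem_sparseSubsets {m : ℕ} {C : Finset ℕ} :
    C ∈ sparseSubsets m ↔ C ⊆ range m ∧ ∀ j ∈ C, j + 1 ∉ C := by
  simp [sparseSubsets]

lemma card_sparseSubsets_add_two_le (m : ℕ) :
    #(sparseSubsets (m + 2)) ≤ #(sparseSubsets (m + 1)) + #(sparseSubsets m) := by
  have hsub : sparseSubsets (m + 2) ⊆
      sparseSubsets (m + 1) ∪ (sparseSubsets m).image (insert (m + 1)) := by
    intro C hC
    rw [mem_sparseSubsets] at hC
    obtain ⟨hC, hs⟩ := hC
    rw [mem_union, mem_image]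
    by_cases hm : m + 1 ∈ C
    · refine Or.inr ⟨C.erase (m + 1), mem_sparseSubsets.2 ⟨fun j hj => ?_, fun j hj => ?_⟩,
        insert_erase hm⟩
      · rw [mem_erase] at hj
        have h1 := mem_range.1 (hC hj.2)
        have h2 : j ≠ m := fun h => hs j hj.2 (h ▸ hm)
        rw [mem_range]
        omega
      · exact fun h => hs j (mem_of_mem_erase hj) (mem_of_mem_erase h)
    · refine Or.inl (mem_sparseSubsets.2 ⟨fun j hj => ?_, hs⟩)
      have h1 := mem_range.1 (hC hj)
      have h2 : j ≠ m + 1 := fun h => hm (h ▸ hj)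
      rw [mem_range]
      omega
  calc #(sparseSubsets (m + 2)) ≤ _ := card_le_card hsub
    _ ≤ _ := card_union_le _ _
    _ ≤ _ := Nat.add_le_add_left card_image_le _

lemma card_sparseSubsets_le {m : ℕ} (hm : 2 ≤ m) :
    (#(sparseSubsets m) : ℝ) ≤ (9 / 5) ^ m := by
  induction m using Nat.strong_induction_on with
  | _ m ih =>
    match m, hm with
    | 2, _ =>
      have : #(sparseSubsets 2) = 3 := by decide
      rw [this]; norm_num
    | 3, _ =>
      have : #(sparseSubsets 3) = 5 := by decide
      rw [this]; norm_num
    | k + 4, _ =>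
      have h1 := ih (k + 3) (by omega) (by omega)
      have h2 := ih (k + 2) (by omega) (by omega)
      have h3 : (#(sparseSubsets (k + 4)) : ℝ) ≤
          #(sparseSubsets (k + 3)) + #(sparseSubsets (k + 2)) :=
        mod_cast card_sparseSubsets_add_two_le (k + 2)
      have h4 : (0 : ℝ) < (9 / 5) ^ k := by positivity
      rw [pow_add] at h1 h2 ⊢
      linarith

/-- Cutting each coset of the subgroup generated by `i` into a path bounds the number of sets
without two elements at difference `i`. -/
lemma card_filter_add_notMem_le_pow {G : Type*} [AddCommGroup G] [Fintype G] [DecidableEq G]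
    (i : G) :
    #{B : Finset G | ∀ b ∈ B, b + i ∉ B} ≤
      #(sparseSubsets (addOrderOf i)) ^ Nat.card (G ⧸ AddSubgroup.zmultiples i) := by
  classical
  have := Fintype.ofFinite (G ⧸ AddSubgroup.zmultiples i)
  rw [Nat.card_eq_fintype_card, ← card_univ, ← prod_const, ← Fintype.card_piFinset]
  refine card_le_card_of_injOn
    (fun B q => {j ∈ range (addOrderOf i) | q.out + j • i ∈ B}) ?_ ?_
  · intro B hB
    simp only [mem_coe, mem_filter, mem_univ, true_and] at hB
    simp only [mem_coe, Fintype.mem_piFinset, mem_sparseSubsets]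
    refine fun q => ⟨filter_subset _ _, fun j hj hj' => ?_⟩
    have h := hB _ (mem_filter.1 hj).2
    rw [add_assoc, ← succ_nsmul] at h
    exact h (mem_filter.1 hj').2
  · intro B _ B' _ h
    ext x
    have hx : -(x : G ⧸ AddSubgroup.zmultiples i).out + x ∈ AddSubgroup.zmultiples i :=
      QuotientAddGroup.eq.1 (QuotientAddGroup.out_eq' _)
    rw [mem_zmultiples_iff_mem_range_addOrderOf, mem_image] at hx
    obtain ⟨j, hj, hjx⟩ := hx
    have h1 := Finset.ext_iff.1 (congrFun h (x : G ⧸ AddSubgroup.zmultiples i)) j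
    simpa [mem_range.1 hj, hjx] using h1

lemma card_filter_add_notMem_le {G : Type*} [AddCommGroup G] [Fintype G] [DecidableEq G]
    (i : G) :
    (#{B : Finset G | ∀ b ∈ B, b + i ∉ B} : ℝ) ≤ (9 / 5) ^ Fintype.card G := by
  rcases eq_or_ne i 0 with rfl | hi
  · have hsub : ({B : Finset G | ∀ b ∈ B, b + 0 ∉ B} : Finset (Finset G)) ⊆ {∅} := by
      intro B hB
      simp only [add_zero, mem_filter, mem_univ, true_and] at hB
      exact mem_singleton.2 (eq_empty_of_forall_notMem fun b hb => hB b hb hb)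
    calc _ ≤ (1 : ℝ) := by exact_mod_cast card_le_card hsub
      _ ≤ _ := one_le_pow₀ (by norm_num)
  · have hm : 2 ≤ addOrderOf i := by
      have h0 := addOrderOf_pos i
      have h1 : addOrderOf i ≠ 1 := fun h => hi (AddMonoid.addOrderOf_eq_one_iff.1 h)
      omega
    have hcard : Fintype.card G =
        addOrderOf i * Nat.card (G ⧸ AddSubgroup.zmultiples i) := by
      rw [← Nat.card_eq_fintype_card,
        AddSubgroup.card_eq_card_quotient_mul_card_addSubgroup (AddSubgroup.zmultiples i),
        Nat.card_zmultiples, mul_comm]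
    calc _ ≤ (#(sparseSubsets (addOrderOf i)) : ℝ) ^
            Nat.card (G ⧸ AddSubgroup.zmultiples i) :=
          mod_cast card_filter_add_notMem_le_pow i
      _ ≤ ((9 / 5) ^ addOrderOf i) ^ Nat.card (G ⧸ AddSubgroup.zmultiples i) := by
          gcongr; exact card_sparseSubsets_le hm
      _ = _ := by rw [← pow_mul, hcard]

/-- Splitting a subset of the dihedral group into its rotations and its reflections. -/
lemma card_filter_r_notMem_mul_le (n : ℕ) [NeZero n] (i : ZMod n) :
    #{S : Finset (DihedralGroup n) | DihedralGroup.r i ∉ S * S} ≤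
      #{A : Finset (ZMod n) | ∀ a ∈ A, i - a ∉ A} *
        #{B : Finset (ZMod n) | ∀ b ∈ B, b + i ∉ B} := by
  rw [← card_product]
  refine card_le_card_of_injOn (fun S => (({a | DihedralGroup.r a ∈ S} : Finset (ZMod n)),
    ({b | DihedralGroup.sr b ∈ S} : Finset (ZMod n)))) ?_ ?_
  · intro S hS
    simp only [mem_coe, mem_filter, mem_univ, true_and] at hS
    simp only [coe_product, Set.mem_prod, mem_coe, mem_filter, mem_univ, true_and]
    refine ⟨fun a ha ha' => hS ?_, fun b hb hb' => hS ?_⟩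
    · simpa using mul_mem_mul ha ha'
    · simpa using mul_mem_mul hb hb'
  · intro S _ T _ h
    simp only [Prod.mk.injEq, Finset.ext_iff, mem_filter, mem_univ, true_and] at h
    ext (a | b)
    · exact h.1 a
    · exact h.2 b

theorem dihedral_rotation_not_in_sumset (n : ℕ) [NeZero n] (i : ZMod n) :
    (((Finset.univ : Finset (DihedralGroup n)).powerset.filter
        (fun S => DihedralGroup.r i ∉ S * S)).card : ℝ) / 2 ^ (2 * n)
      ≤ ((3 : ℝ) / 4) ^ ((n : ℝ) / 2) * ((9 : ℝ) / 10) ^ n := by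
  rw [powerset_univ]
  have hS := card_filter_r_notMem_mul_le n i
  have hA := card_filter_involutive_sq_le (g := fun a : ZMod n => i - a) (fun a => by simp)
  have hB := card_filter_add_notMem_le i
  rw [ZMod.card] at hA hB
  set s := #{S : Finset (DihedralGroup n) | DihedralGroup.r i ∉ S * S}
  set a := #{A : Finset (ZMod n) | ∀ a ∈ A, i - a ∉ A}
  set b := #{B : Finset (ZMod n) | ∀ b ∈ B, b + i ∉ B}
  have hpow : (((3 : ℝ) / 4) ^ ((n : ℝ) / 2)) ^ 2 = (3 / 4) ^ n := by
    rw [← Real.rpow_natCast, ← Real.rpow_mul (by norm_num)]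
    simp
  have hA' : (a : ℝ) / 2 ^ n ≤ ((3 : ℝ) / 4) ^ ((n : ℝ) / 2) := by
    refine le_of_sq_le_sq ?_ (by positivity)
    have h4 : ((2 : ℝ) ^ n) ^ 2 = 4 ^ n := by
      rw [← pow_mul, mul_comm, pow_mul]; norm_num
    rw [hpow, div_pow, div_pow, h4]
    gcongr
    exact_mod_cast hA
  have hB' : (b : ℝ) / 2 ^ n ≤ (9 / 10) ^ n := by
    have h9 : (9 / 10 : ℝ) ^ n = (9 / 5) ^ n / 2 ^ n := by
      rw [← div_pow]; norm_num
    rw [h9]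
    gcongr
  calc (s : ℝ) / 2 ^ (2 * n) ≤ (a * b : ℝ) / 2 ^ (2 * n) := by
        gcongr
        exact_mod_cast hS
    _ = a / 2 ^ n * (b / 2 ^ n) := by rw [two_mul, pow_add, mul_div_mul_comm]
    _ ≤ _ := by gcongr
end

section
/- Let S be a uniformly random subset of the dihedral group D_{2n}. Then P(|S·S| = |S·S^{-1}|) → 1 as n → ∞. Formally: the ratio (number of finsets S of DihedralGroup n with (S * S).card = (S / S).card) / 2^(2n) tends to 1 as n → ∞. -/
open Finset Filter
open scoped Pointwise

/-- An injective self-map of a finite type admits a subset containing at least a third of the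
points whose associated pairs `{x, f x}` are pairwise disjoint. -/
theorem exists_large_disjoint_pairs {α : Type*} [Fintype α] [DecidableEq α] {f : α → α}
    (hf : Function.Injective f) :
    ∃ T : Finset α, (∀ x ∈ T, ∀ y ∈ T, x ≠ y → f x ≠ y) ∧ Fintype.card α ≤ 3 * T.card := by
  classical
  obtain ⟨T, hT, hmax⟩ := Finset.exists_max_image
    ((Finset.univ : Finset (Finset α)).filter fun T => ∀ x ∈ T, ∀ y ∈ T, x ≠ y → f x ≠ y)
    Finset.card ⟨∅, by simp⟩
  simp only [Finset.mem_filter, Finset.mem_univ, true_and] at hT hmax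
  refine ⟨T, hT, ?_⟩
  have hcover : (Finset.univ : Finset α) ⊆ T ∪ T.image f ∪ T.preimage f hf.injOn := by
    intro z _
    by_contra hz
    simp only [Finset.mem_union, Finset.mem_image, Finset.mem_preimage, not_or, not_exists,
      not_and] at hz
    obtain ⟨⟨hzT, hzf⟩, hfz⟩ := hz
    have hle := hmax (insert z T) (by
      intro x hx y hy hxy hfxy
      rw [Finset.mem_insert] at hx hy
      grind)
    rw [Finset.card_insert_of_notMem hzT] at hle
    omega
  have hpre : (T.preimage f hf.injOn).card ≤ T.card :=
    Finset.card_le_card_of_injOn f (fun x hx => by simpa using hx) hf.injOn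
  have h₁ := Finset.card_le_card hcover
  have h₂ := Finset.card_union_le (T ∪ T.image f) (T.preimage f hf.injOn)
  have h₃ := Finset.card_union_le T (T.image f)
  have h₄ := Finset.card_image_le (s := T) (f := f)
  rw [Finset.card_univ] at h₁
  omega

/-- Each of the disjoint pairs `{x, f x}`, `x ∈ T`, is avoided by at most three quarters of all
subsets, independently of the others. -/
theorem card_avoiding_pairs_le {α : Type*} [Fintype α] [DecidableEq α] {f : α → α}
    (hf : Function.Injective f) (T : Finset α) (hT : ∀ x ∈ T, ∀ y ∈ T, x ≠ y → f x ≠ y) :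
    4 ^ T.card * ((Finset.univ : Finset (Finset α)).filter
        fun S => ∀ x ∈ T, ¬ (x ∈ S ∧ f x ∈ S)).card
      ≤ 3 ^ T.card * 2 ^ Fintype.card α := by
  induction T using Finset.induction_on with
  | empty => simp
  | insert a T ha ih =>
    have ih := ih fun x hx y hy => hT x (Finset.mem_insert_of_mem hx) y (Finset.mem_insert_of_mem hy)
    set F := (Finset.univ : Finset (Finset α)).filter fun S => ∀ x ∈ T, ¬ (x ∈ S ∧ f x ∈ S)
      with hF
    have hsplit := Finset.card_filter_add_card_filter_not (s := F) fun S => a ∈ S ∧ f a ∈ S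
    have hstep : (Finset.univ : Finset (Finset α)).filter
        (fun S => ∀ x ∈ insert a T, ¬ (x ∈ S ∧ f x ∈ S)) =
        F.filter fun S => ¬ (a ∈ S ∧ f a ∈ S) := by
      ext S
      simp only [hF, Finset.mem_filter, Finset.mem_univ, true_and, Finset.forall_mem_insert]
      tauto
    have hfour : F.card ≤ (F.filter fun S => a ∈ S ∧ f a ∈ S).card * 4 := by
      have hinj : F.card ≤ ((F.filter fun S => a ∈ S ∧ f a ∈ S) ×ˢ
          ({a, f a} : Finset α).powerset).card := by
        refine Finset.card_le_card_of_injOn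
          (fun S => (S ∪ {a, f a}, S ∩ {a, f a})) ?_ ?_
        · intro S hS
          simp only [hF, Finset.coe_filter, Finset.mem_univ, true_and, Set.mem_ofPred_eq] at hS
          simp only [hF, Finset.coe_product, Set.mem_prod, Finset.mem_coe, Finset.mem_filter,
            Finset.mem_univ, true_and, Finset.mem_powerset, Finset.inter_subset_right, and_true]
          refine ⟨fun x hx => ?_, by simp⟩
          have hxa : x ≠ a := fun h => ha (h ▸ hx)
          have h₁ := hT x (by simp [hx]) a (by simp) hxa
          have h₂ := hT a (by simp) x (by simp [hx]) hxa.symm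
          have h₃ : f x ≠ f a := fun h => hxa (hf h)
          simpa [hxa, h₁, h₂.symm, h₃] using hS x hx
        · intro S _ S' _ h
          simp only [Prod.mk.injEq] at h
          ext x
          have h₁ := Finset.ext_iff.mp h.1 x
          have h₂ := Finset.ext_iff.mp h.2 x
          simp only [Finset.mem_union, Finset.mem_inter] at h₁ h₂
          tauto
      rw [Finset.card_product, Finset.card_powerset] at hinj
      refine hinj.trans (Nat.mul_le_mul_left _ ?_)
      calc 2 ^ ({a, f a} : Finset α).card ≤ 2 ^ 2 :=
            Nat.pow_le_pow_right (by norm_num) Finset.card_le_two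
        _ = 4 := by norm_num
    rw [hstep, Finset.card_insert_of_notMem ha, pow_succ, pow_succ]
    have hthree : 4 * (F.filter fun S => ¬ (a ∈ S ∧ f a ∈ S)).card ≤ 3 * F.card := by omega
    calc 4 ^ T.card * 4 * (F.filter fun S => ¬ (a ∈ S ∧ f a ∈ S)).card
        = 4 ^ T.card * (4 * (F.filter fun S => ¬ (a ∈ S ∧ f a ∈ S)).card) := by ring
      _ ≤ 4 ^ T.card * (3 * F.card) := Nat.mul_le_mul_left _ hthree
      _ = 3 * (4 ^ T.card * F.card) := by ring
      _ ≤ 3 * (3 ^ T.card * 2 ^ Fintype.card α) := Nat.mul_le_mul_left _ ih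
      _ = 3 ^ T.card * 3 * 2 ^ Fintype.card α := by ring

/-- Few subsets contain no pair `x, f x` for a given injective self-map `f`. -/
theorem card_no_pair_le {α : Type*} [Fintype α] [DecidableEq α] {f : α → α}
    (hf : Function.Injective f) :
    (((Finset.univ : Finset (Finset α)).filter fun S => ∀ x, ¬ (x ∈ S ∧ f x ∈ S)).card : ℝ)
      ≤ (3 / 4) ^ (Fintype.card α / 3) * 2 ^ Fintype.card α := by
  obtain ⟨T, hT, hcard⟩ := exists_large_disjoint_pairs hf
  have hle := card_avoiding_pairs_le hf T hT
  have hsub : ((Finset.univ : Finset (Finset α)).filter fun S => ∀ x, ¬ (x ∈ S ∧ f x ∈ S)).card ≤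
      ((Finset.univ : Finset (Finset α)).filter fun S => ∀ x ∈ T, ¬ (x ∈ S ∧ f x ∈ S)).card :=
    Finset.card_le_card (Finset.monotone_filter_right _ fun S _ h x _ => h x)
  have hle' := (Nat.mul_le_mul_left (4 ^ T.card) hsub).trans hle
  have hreal : (4 : ℝ) ^ T.card *
      ((Finset.univ : Finset (Finset α)).filter fun S => ∀ x, ¬ (x ∈ S ∧ f x ∈ S)).card
      ≤ 3 ^ T.card * 2 ^ Fintype.card α := by exact_mod_cast hle'
  calc _ ≤ ((3 : ℝ) / 4) ^ T.card * 2 ^ Fintype.card α := by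
        rw [div_pow, div_mul_eq_mul_div, le_div_iff₀ (by positivity)]
        linarith
    _ ≤ _ := by
        gcongr ?_ * _
        exact pow_le_pow_of_le_one (by norm_num) (by norm_num) (by omega)

/-- In a finite group, few subsets `S` have `|S * S| ≠ |S / S|`. -/
theorem card_not_balanced_le (G : Type*) [Group G] [Fintype G] [DecidableEq G] :
    (((Finset.univ : Finset (Finset G)).filter fun S => ¬ (S * S).card = (S / S).card).card : ℝ)
      ≤ 2 * Fintype.card G * ((3 / 4) ^ (Fintype.card G / 3) * 2 ^ Fintype.card G) := by
  let N : (G → G) → Finset (Finset G) := fun f =>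
    Finset.univ.filter fun S => ∀ x, ¬ (x ∈ S ∧ f x ∈ S)
  have hsub : ((Finset.univ : Finset (Finset G)).filter fun S => ¬ (S * S).card = (S / S).card) ⊆
      Finset.univ.biUnion fun g : G => N (fun x => g * x⁻¹) ∪ N (fun x => g * x) := by
    intro S hS
    simp only [Finset.mem_filter, Finset.mem_univ, true_and] at hS
    by_contra hcon
    simp only [N, Finset.mem_biUnion, Finset.mem_univ, true_and, Finset.mem_union,
      Finset.mem_filter, not_exists, not_or, not_forall, not_not] at hcon
    apply hS
    have hmul : S * S = Finset.univ := Finset.eq_univ_of_forall fun g => by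
      obtain ⟨⟨x, hx, hgx⟩, -⟩ := hcon g
      simpa using Finset.mul_mem_mul hgx hx
    have hdiv : S / S = Finset.univ := Finset.eq_univ_of_forall fun g => by
      obtain ⟨-, x, hx, hgx⟩ := hcon g
      simpa using Finset.div_mem_div hgx hx
    rw [hmul, hdiv]
  have hbound : ∀ g : G, ((N (fun x => g * x⁻¹) ∪ N (fun x => g * x)).card : ℝ) ≤
      2 * ((3 / 4) ^ (Fintype.card G / 3) * 2 ^ Fintype.card G) := by
    intro g
    have h₁ := card_no_pair_le (f := fun x : G => g * x⁻¹) fun x y h => by simpa using h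
    have h₂ := card_no_pair_le (f := fun x : G => g * x) fun x y h => by simpa using h
    have h₃ : ((N (fun x => g * x⁻¹) ∪ N (fun x => g * x)).card : ℝ) ≤
        (N (fun x => g * x⁻¹)).card + (N (fun x => g * x)).card := by
      exact_mod_cast Finset.card_union_le _ _
    linarith
  calc _ ≤ ((Finset.univ.biUnion fun g : G =>
          N (fun x => g * x⁻¹) ∪ N (fun x => g * x)).card : ℝ) := by
        exact_mod_cast Finset.card_le_card hsub
    _ ≤ ∑ g : G, ((N (fun x => g * x⁻¹) ∪ N (fun x => g * x)).card : ℝ) := by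
        exact_mod_cast Finset.card_biUnion_le
    _ ≤ ∑ _g : G, 2 * ((3 / 4 : ℝ) ^ (Fintype.card G / 3) * 2 ^ Fintype.card G) :=
        Finset.sum_le_sum fun g _ => hbound g
    _ = _ := by
        rw [Finset.sum_const, Finset.card_univ, nsmul_eq_mul]
        ring

theorem tendsto_mul_pow_div_three :
    Tendsto (fun m : ℕ => 2 * (m : ℝ) * (3 / 4) ^ (m / 3)) atTop (nhds 0) := by
  have hdiv : Tendsto (fun m : ℕ => m / 3) atTop atTop :=
    Nat.tendsto_div_const_atTop (by norm_num)
  have h₁ := (tendsto_self_mul_const_pow_of_lt_one (r := (3 / 4 : ℝ)) (by norm_num)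
    (by norm_num)).comp hdiv
  have h₂ := (tendsto_pow_atTop_nhds_zero_of_lt_one (r := (3 / 4 : ℝ)) (by norm_num)
    (by norm_num)).comp hdiv
  have h₃ := (h₁.const_mul 6).add (h₂.const_mul 4)
  simp only [mul_zero, add_zero] at h₃
  refine squeeze_zero (fun m => by positivity) (fun m => ?_) h₃
  have hm : (m : ℝ) ≤ 3 * (m / 3 : ℕ) + 2 := by
    exact_mod_cast (by omega : m ≤ 3 * (m / 3) + 2)
  have hpos : (0 : ℝ) ≤ (3 / 4) ^ (m / 3) := by positivity
  simp only [Function.comp_apply]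
  nlinarith [mul_le_mul_of_nonneg_right hm hpos]

theorem dihedral_most_subsets_balanced :
    Tendsto
      (fun n : ℕ =>
        (((Finset.univ : Finset (DihedralGroup (n + 1))).powerset.filter
            (fun S => (S * S).card = (S / S).card)).card : ℝ)
          / 2 ^ (2 * (n + 1)))
      atTop (nhds 1) := by
  have hindex : Tendsto (fun n : ℕ => 2 * (n + 1)) atTop atTop :=
    tendsto_atTop_mono (fun n => by omega : ∀ n : ℕ, n ≤ 2 * (n + 1)) tendsto_id
  have hlim := (tendsto_mul_pow_div_three.comp hindex).const_sub 1
  rw [sub_zero] at hlim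
  have key : ∀ n : ℕ,
      (((Finset.univ : Finset (DihedralGroup (n + 1))).powerset.filter
          (fun S => (S * S).card = (S / S).card)).card : ℝ) +
        ((Finset.univ : Finset (Finset (DihedralGroup (n + 1)))).filter
          (fun S => ¬ (S * S).card = (S / S).card)).card = 2 ^ (2 * (n + 1)) := by
    intro n
    rw [Finset.powerset_univ]
    have h := Finset.card_filter_add_card_filter_not
      (s := (Finset.univ : Finset (Finset (DihedralGroup (n + 1)))))
      fun S => (S * S).card = (S / S).card
    rw [Finset.card_univ, Fintype.card_finset, DihedralGroup.card] at h
    exact_mod_cast h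
  refine tendsto_of_tendsto_of_tendsto_of_le_of_le hlim tendsto_const_nhds
    (fun n => ?_) (fun n => ?_)
  · have h := card_not_balanced_le (DihedralGroup (n + 1))
    rw [DihedralGroup.card] at h
    simp only [Function.comp_apply]
    rw [le_div_iff₀ (by positivity)]
    linarith [key n]
  · simp only
    rw [div_le_one (by positivity), ← key n]
    exact le_add_of_nonneg_right (Nat.cast_nonneg _)
end
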